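/- Let N = ((V ∪ {s}, A), τ) be an acyclic pre-flow temporal network. Then for every vertex v ∈ V, the maximum number of pairwise arc-disjoint τ-respecting (s,v)-paths equals the in-degree of v, i.e., λ_N(s,v) = d^-_D(v). -/

import Mathlib

/-- A directed graph (possibly with parallel arcs): arc type `At`, vertex type `Vt`,
each arc has a tail and a head. -/
structure Dgraph (Vt At : Type) where
  tail : At → Vt
  head : At → Vt

namespace Dgraph

variable {Vt At : Type}

/-- `D.WalkFrom u p v` : the list of arcs `p` forms a directed walk from `u` to `v`. -/
def WalkFrom (D : Dgraph Vt At) : Vt → List At → Vt → Prop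
  | u, [], v => u = v
  | u, a :: p, v => D.tail a = u ∧ D.WalkFrom (D.head a) p v

/-- The vertices visited by a walk starting at `u` with arc list `p`. -/
def walkVerts (D : Dgraph Vt At) (u : Vt) (p : List At) : List Vt :=
  u :: p.map D.head

/-- A directed path from `u` to `v`: a walk visiting pairwise distinct vertices. -/
def IsPath (D : Dgraph Vt At) (u : Vt) (p : List At) (v : Vt) : Prop :=
  D.WalkFrom u p v ∧ (D.walkVerts u p).Nodup

/-- An arc list is τ-respecting if its τ-values are non-decreasing. -/
def Respects (τ : At → ℕ) (p : List At) : Prop :=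
  List.Chain' (· ≤ ·) (p.map τ)

/-- An arc list is monochromatic w.r.t. a colouring `c` if all its arcs get the same colour. -/
def Monochromatic (c : At → Bool) (p : List At) : Prop :=
  ∀ a ∈ p, ∀ b ∈ p, c a = c b

/-- There is no directed cycle using only arcs of `B`
(equivalently, no nonempty closed directed walk inside `B`). -/
def AcyclicOn (D : Dgraph Vt At) (B : Set At) : Prop :=
  ¬ ∃ (v : Vt) (p : List At), p ≠ [] ∧ (∀ a ∈ p, a ∈ B) ∧ D.WalkFrom v p v

/-- The directed graph contains no directed cycle. -/
def Acyclic (D : Dgraph Vt At) : Prop :=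
  D.AcyclicOn Set.univ

/-- `u` reaches `v` by a directed walk. -/
def Reaches (D : Dgraph Vt At) (u v : Vt) : Prop :=
  ∃ p : List At, D.WalkFrom u p v

/-- `u` and `v` are in the same strongly connected component. -/
def MutuallyReachable (D : Dgraph Vt At) (u v : Vt) : Prop :=
  D.Reaches u v ∧ D.Reaches v u

/-- A temporal network `(D, τ)` is consistent if any two arcs lying in the same strongly
connected component (i.e. whose endpoints are all mutually reachable) have the same τ-value. -/
def Consistent (D : Dgraph Vt At) (τ : At → ℕ) : Prop :=
  ∀ a b : At,
    D.MutuallyReachable (D.tail a) (D.head a) →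
    D.MutuallyReachable (D.tail b) (D.head b) →
    D.MutuallyReachable (D.tail a) (D.tail b) →
    τ a = τ b

section Fin

variable [DecidableEq Vt] [Fintype At]

/-- The vertex set of the subgraph with arc set `B`, together with the root `s`. -/
def vertsF (D : Dgraph Vt At) (s : Vt) (B : Finset At) : Finset Vt :=
  insert s (B.image D.tail ∪ B.image D.head)

/-- In-degree of `v` in the subgraph with arc set `B`. -/
def indegOn (D : Dgraph Vt At) (B : Finset At) (v : Vt) : ℕ :=
  (B.filter (fun a => D.head a = v)).card

/-- In-degree of `v`. -/
def indeg (D : Dgraph Vt At) (v : Vt) : ℕ :=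
  D.indegOn Finset.univ v

/-- Out-degree of `v`. -/
def outdeg (D : Dgraph Vt At) (v : Vt) : ℕ :=
  (Finset.univ.filter (fun a => D.tail a = v)).card

/-- `ρ^i_N(v)` : the set of arcs entering `v` with τ-value at most `i`. -/
def rhoLe (D : Dgraph Vt At) (τ : At → ℕ) (v : Vt) (i : ℕ) : Finset At :=
  Finset.univ.filter (fun a => D.head a = v ∧ τ a ≤ i)

/-- `δ^i_N(v)` : the set of arcs leaving `v` with τ-value at most `i`. -/
def deltaLe (D : Dgraph Vt At) (τ : At → ℕ) (v : Vt) (i : ℕ) : Finset At :=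
  Finset.univ.filter (fun a => D.tail a = v ∧ τ a ≤ i)

/-- The temporal network `(D, τ)` with root `s` is pre-flow:
`|ρ^i_N(v)| ≥ |δ^i_N(v)|` for every `i` and every non-root vertex `v`. -/
def Preflow (D : Dgraph Vt At) (τ : At → ℕ) (s : Vt) : Prop :=
  ∀ (i : ℕ) (v : Vt), v ≠ s → (D.deltaLe τ v i).card ≤ (D.rhoLe τ v i).card

/-- The arc set `B` induces an `s`-arborescence: the subgraph contains `s`,
has no directed cycle, and every vertex of it other than `s` has in-degree exactly 1. -/
def IsArb (D : Dgraph Vt At) (s : Vt) (B : Finset At) : Prop :=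
  D.AcyclicOn (↑B) ∧ ∀ v ∈ D.vertsF s B, v ≠ s → D.indegOn B v = 1

/-- The arc set `B` induces a τ-respecting `s`-arborescence: an `s`-arborescence in which,
for every vertex `v` of the arborescence, the (unique) path from `s` to `v` is τ-respecting. -/
def IsTArb (D : Dgraph Vt At) (τ : At → ℕ) (s : Vt) (B : Finset At) : Prop :=
  D.IsArb s B ∧
    ∀ v ∈ D.vertsF s B, ∀ p : List At, (∀ a ∈ p, a ∈ B) → D.IsPath s p v → Respects τ p

/-- There exist `k` pairwise arc-disjoint τ-respecting directed paths from `s` to `v`. -/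
def HasTPaths (D : Dgraph Vt At) (τ : At → ℕ) (s v : Vt) (k : ℕ) : Prop :=
  ∃ P : Fin k → List At,
    (∀ i, D.IsPath s (P i) v ∧ Respects τ (P i)) ∧
    ∀ i j, i ≠ j → ∀ a, a ∈ P i → a ∉ P j

/-- `λ_N(s,v)` : the maximum number of pairwise arc-disjoint τ-respecting `(s,v)`-paths. -/
noncomputable def lambdaT (D : Dgraph Vt At) (τ : At → ℕ) (s v : Vt) : ℕ :=
  sSup {k | D.HasTPaths τ s v k}

/-- `λ_D(s,v)` : the maximum number of pairwise arc-disjoint `(s,v)`-paths. -/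
noncomputable def lambda (D : Dgraph Vt At) (s v : Vt) : ℕ :=
  D.lambdaT (fun _ => 0) s v

end Fin

end Dgraph

namespace Dgraph

section Walks

variable {Vt At : Type} {D : Dgraph Vt At}

theorem WalkFrom.append {u v w : Vt} {p q : List At}
    (hp : D.WalkFrom u p v) (hq : D.WalkFrom v q w) : D.WalkFrom u (p ++ q) w := by
  induction p generalizing u with
  | nil => obtain rfl : u = v := hp; exact hq
  | cons a p ih => exact ⟨hp.1, ih hp.2⟩

theorem WalkFrom.singleton {a : At} {u : Vt} (h : D.tail a = u) : D.WalkFrom u [a] (D.head a) :=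
  ⟨h, rfl⟩

theorem respects_iff_pairwise {τ : At → ℕ} {p : List At} :
    Respects τ p ↔ (p.map τ).Pairwise (· ≤ ·) :=
  List.isChain_iff_pairwise

theorem WalkFrom.reaches_of_mem_walkVerts {u v x : Vt} {p : List At}
    (hp : D.WalkFrom u p v) (hx : x ∈ D.walkVerts u p) : D.Reaches u x := by
  induction p generalizing u with
  | nil =>
    obtain rfl : x = u := by simpa [walkVerts] using hx
    exact ⟨[], rfl⟩
  | cons a p ih =>
    rcases List.mem_cons.1 hx with rfl | hx
    · exact ⟨[], rfl⟩
    · obtain ⟨q, hq⟩ := ih hp.2 hx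
      exact ⟨a :: q, hp.1, hq⟩

theorem WalkFrom.exists_mem_head_eq {u v : Vt} {p : List At}
    (hp : D.WalkFrom u p v) (huv : u ≠ v) : ∃ a ∈ p, D.head a = v := by
  induction p generalizing u with
  | nil => exact absurd hp huv
  | cons a p ih =>
    by_cases h : D.head a = v
    · exact ⟨a, by simp, h⟩
    · obtain ⟨b, hb, hbv⟩ := ih hp.2 h
      exact ⟨b, by simp [hb], hbv⟩

theorem Acyclic.eq_nil (hD : D.Acyclic) {v : Vt} {p : List At} (hp : D.WalkFrom v p v) :
    p = [] := by
  by_contra hne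
  exact hD ⟨v, p, hne, fun _ _ => Set.mem_univ _, hp⟩

theorem Acyclic.nodup_walkVerts (hD : D.Acyclic) {u v : Vt} {p : List At}
    (hp : D.WalkFrom u p v) : (D.walkVerts u p).Nodup := by
  induction p generalizing u with
  | nil => simp [walkVerts]
  | cons a p ih =>
    refine List.nodup_cons.2 ⟨fun hu => ?_, ih hp.2⟩
    obtain ⟨q, hq⟩ := hp.2.reaches_of_mem_walkVerts (x := u) hu
    exact List.cons_ne_nil a q (hD.eq_nil (v := u) ⟨hp.1, hq⟩)

theorem exists_walkFrom_of_transGen {a b : At}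
    (h : Relation.TransGen (fun x y => D.head x = D.tail y) a b) :
    ∃ p, p ≠ [] ∧ D.WalkFrom (D.head a) p (D.head b) := by
  induction h with
  | single h => exact ⟨_, List.cons_ne_nil _ _, WalkFrom.singleton h.symm⟩
  | tail _ h ih =>
    obtain ⟨p, -, hp⟩ := ih
    exact ⟨p ++ [_], by simp, hp.append (WalkFrom.singleton h.symm)⟩

theorem Acyclic.head_ne_of_transGen (hD : D.Acyclic) {a b : At}
    (h : Relation.TransGen (fun x y => D.head x = D.tail y) a b) : D.head a ≠ D.head b := by
  intro hab
  obtain ⟨p, hne, hp⟩ := exists_walkFrom_of_transGen h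
  rw [← hab] at hp
  exact hne (hD.eq_nil hp)

theorem Acyclic.wellFounded [Finite At] (hD : D.Acyclic) :
    WellFounded (fun x y => D.head x = D.tail y) := by
  have : Std.Irrefl (Relation.TransGen fun x y => D.head x = D.tail y) :=
    ⟨fun _ h => hD.head_ne_of_transGen h rfl⟩
  exact (Finite.wellFounded_of_trans_of_irrefl
    (Relation.TransGen fun x y => D.head x = D.tail y)).mono fun _ _ h => .single h

/-- If every arc not leaving `s` has an `R`-predecessor, and `R` relates only consecutive arcs with
non-decreasing labels, then every arc ends a τ-respecting walk from `s` made of `R`-ancestors. -/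
theorem Acyclic.exists_respects_walkFrom [Finite At] (hD : D.Acyclic) {τ : At → ℕ} {s : Vt}
    {R : At → At → Prop} (hhead : ∀ x y, R x y → D.head x = D.tail y)
    (hle : ∀ x y, R x y → τ x ≤ τ y) (hex : ∀ y, D.tail y ≠ s → ∃ x, R x y) (a : At) :
    ∃ p, D.WalkFrom s p (D.head a) ∧ Respects τ p ∧
      ∀ c ∈ p, Relation.ReflTransGen R c a := by
  induction a using hD.wellFounded.induction with
  | _ a ih =>
  by_cases ha : D.tail a = s
  · refine ⟨[a], WalkFrom.singleton ha, by simp [respects_iff_pairwise], fun c hc => ?_⟩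
    rw [List.mem_singleton.1 hc]
  · obtain ⟨b, hba⟩ := hex a ha
    obtain ⟨p, hp, hτ, hR⟩ := ih b (hhead b a hba)
    have hRa : ∀ c ∈ p, Relation.ReflTransGen R c a := fun c hc => (hR c hc).tail hba
    have hmono : ∀ c, Relation.ReflTransGen R c a → τ c ≤ τ a := fun c hc => by
      induction hc using Relation.ReflTransGen.head_induction_on with
      | refl => exact le_rfl
      | head h _ ih => exact (hle _ _ h).trans ih
    refine ⟨p ++ [a], hp.append (WalkFrom.singleton (hhead b a hba).symm), ?_, ?_⟩
    · rw [respects_iff_pairwise] at hτ ⊢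
      rw [List.map_append, List.pairwise_append]
      refine ⟨hτ, by simp, ?_⟩
      simpa using fun c hc => hmono c (hRa c hc)
    · intro c hc
      rcases List.mem_append.1 hc with hc | hc
      · exact hRa c hc
      · rw [List.mem_singleton.1 hc]

/-- Arcs with a common head have no common ancestor under a relation with unique successors. -/
theorem Acyclic.eq_of_common_ancestor (hD : D.Acyclic) {R : At → At → Prop}
    (hhead : ∀ x y, R x y → D.head x = D.tail y) (hR : Relator.RightUnique R) {a b c : At}
    (hca : Relation.ReflTransGen R c a) (hcb : Relation.ReflTransGen R c b)
    (hab : D.head a = D.head b) : a = b := by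
  rcases Relation.ReflTransGen.total_of_right_unique hR hca hcb with h | h <;>
    rcases Relation.reflTransGen_iff_eq_or_transGen.1 h with h | h
  · exact h.symm
  · exact absurd hab (hD.head_ne_of_transGen (Relation.TransGen.mono hhead _ _ h))
  · exact h
  · exact absurd hab.symm (hD.head_ne_of_transGen (Relation.TransGen.mono hhead _ _ h))

end Walks

section Counting

variable {Vt At : Type} [DecidableEq Vt] [Fintype At] {D : Dgraph Vt At} {τ : At → ℕ} {s : Vt}

/-- In a pre-flow network the arcs leaving `v` can be matched injectively to arcs entering `v`
with no larger label. -/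
theorem Preflow.exists_injective_pred [DecidableEq At] (hpre : D.Preflow τ s) {v : Vt}
    (hv : v ≠ s) :
    ∃ f : {a : At // D.tail a = v} → At, Function.Injective f ∧
      ∀ a, D.head (f a) = v ∧ τ (f a) ≤ τ a := by
  have hall := (Finset.all_card_le_biUnion_card_iff_exists_injective
    (fun a : {a : At // D.tail a = v} => D.rhoLe τ v (τ a))).1 fun S => by
      rcases S.eq_empty_or_nonempty with rfl | hS
      · simp
      obtain ⟨m, hm, hmax⟩ := S.exists_max_image (fun a => τ a) hS
      calc S.card = (S.map (Function.Embedding.subtype _)).card := (Finset.card_map _).symm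
        _ ≤ (D.deltaLe τ v (τ m)).card := Finset.card_le_card fun a ha => by
          obtain ⟨b, hb, rfl⟩ := Finset.mem_map.1 ha
          simpa [deltaLe] using ⟨b.2, hmax b hb⟩
        _ ≤ (D.rhoLe τ v (τ m)).card := hpre _ v hv
        _ ≤ _ := Finset.card_le_card
          (Finset.subset_biUnion_of_mem (fun a : {a : At // D.tail a = v} => D.rhoLe τ v (τ a)) hm)
  obtain ⟨f, hf, hmem⟩ := hall
  exact ⟨f, hf, fun a => by simpa [rhoLe] using hmem a⟩

theorem Preflow.exists_pred_relation [DecidableEq At] (hpre : D.Preflow τ s) :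
    ∃ R : At → At → Prop, (∀ x y, R x y → D.head x = D.tail y) ∧ (∀ x y, R x y → τ x ≤ τ y) ∧
      (∀ y, D.tail y ≠ s → ∃ x, R x y) ∧ Relator.RightUnique R := by
  choose f hinj hf using fun (v : Vt) (hv : v ≠ s) => hpre.exists_injective_pred hv
  refine ⟨fun x y => ∃ h : D.tail y ≠ s, x = f _ h ⟨y, rfl⟩, ?_, ?_, ?_, ?_⟩
  · rintro _ y ⟨h, rfl⟩
    exact (hf _ h _).1
  · rintro _ y ⟨h, rfl⟩
    exact (hf _ h ⟨y, rfl⟩).2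
  · exact fun y h => ⟨_, h, rfl⟩
  · rintro x y z ⟨hy, rfl⟩ ⟨hz, hyz⟩
    have htail : D.tail z = D.tail y := by
      rw [← (hf _ hz ⟨z, rfl⟩).1, ← hyz, (hf _ hy ⟨y, rfl⟩).1]
    have hval : ∀ (v w : Vt) (hv : v ≠ s) (hw : w ≠ s) (hvz : D.tail z = v) (hwz : D.tail z = w),
        f v hv ⟨z, hvz⟩ = f w hw ⟨z, hwz⟩ := by
      rintro _ _ _ _ rfl rfl
      rfl
    exact congrArg Subtype.val (hinj _ hy (hyz.trans (hval _ _ hz hy rfl htail)))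

theorem HasTPaths.le_indeg {v : Vt} {k : ℕ} (hv : v ≠ s) (h : D.HasTPaths τ s v k) :
    k ≤ D.indeg v := by
  obtain ⟨P, hP, hdisj⟩ := h
  choose g hg hgv using fun i => (hP i).1.1.exists_mem_head_eq hv.symm
  have hinj : Function.Injective g := fun i j hij => by
    by_contra hne
    exact hdisj i j hne _ (hg i) (hij ▸ hg j)
  simpa [indeg, indegOn] using Finset.card_le_card_of_injOn (s := Finset.univ)
    (t := Finset.univ.filter fun a => D.head a = v) g (by simp [Set.MapsTo, hgv]) hinj.injOn

theorem Acyclic.hasTPaths_indeg [DecidableEq At] (hD : D.Acyclic) (hpre : D.Preflow τ s) (v : Vt) :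
    D.HasTPaths τ s v (D.indeg v) := by
  obtain ⟨R, hhead, hle, hex, huniq⟩ := hpre.exists_pred_relation
  choose P hwalk hτ hanc using hD.exists_respects_walkFrom hhead hle hex
  let e := (Finset.univ.filter fun a => D.head a = v).equivFin.symm
  have he : ∀ i, D.head (e i) = v := fun i => (Finset.mem_filter.1 (e i).2).2
  refine ⟨fun i => P (e i), fun i => ⟨?_, hτ _⟩, fun i j hij a hi hj => hij ?_⟩
  · have hw := hwalk (e i)
    rw [show D.head (e i) = v from he i] at hw
    exact ⟨hw, hD.nodup_walkVerts hw⟩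
  · exact e.injective (Subtype.ext (hD.eq_of_common_ancestor hhead huniq (hanc _ _ hi)
      (hanc _ _ hj) ((he i).trans (he j).symm)))

end Counting

end Dgraph


/-- In an acyclic pre-flow temporal network `N = ((V ∪ {s}, A), τ)`,
for every vertex `v ∈ V` the maximum number of pairwise arc-disjoint τ-respecting
`(s,v)`-paths equals the in-degree of `v`: `λ_N(s,v) = d⁻_D(v)`. -/
theorem lambdaT_eq_indeg_of_acyclic_preflow
    {Vt At : Type} [Fintype Vt] [DecidableEq Vt] [Fintype At] [DecidableEq At]
    (D : Dgraph Vt At) (τ : At → ℕ) (s : Vt)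
    (hroot : ∀ a : At, D.head a ≠ s)
    (hacyc : D.Acyclic)
    (hpre : D.Preflow τ s) :
    ∀ v : Vt, v ≠ s → D.lambdaT τ s v = D.indeg v := by
  intro v hv
  exact IsGreatest.csSup_eq ⟨hacyc.hasTPaths_indeg hpre v, fun _ h => h.le_indeg hv⟩
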